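/- (Proposition 2.1, second part) Let g : ℝⁿ → ℝⁿ be a homeomorphism, Q ⊆ ℝⁿ a compact set, and let A_Q = ⋂_{j≥0} g^j(Q) be the global attractor relative to Q. Suppose the sequence 𝓑₀, 𝓑₁, 𝓑₂, … is generated by the subdivision scheme with contraction factor 0 < θ < 1, and set Q_k = ⋃_{B ∈ 𝓑_k} B and Q_∞ = ⋂_{k≥0} Q_k. Then A_Q = Q_∞. -/

import Mathlib

/-- The sequence of finite collections `𝓑 k` of nonempty compact subsets of `ℝⁿ` is
generated by the subdivision scheme for the homeomorphism `g`, the compact set `Q` and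
the contraction factor `θ` if:
(i) `⋃_{B ∈ 𝓑 0} B = Q`;
(ii) for each `k` there is a finite collection `𝓑̂` of nonempty compact sets with
`⋃_{B ∈ 𝓑̂} B = ⋃_{B ∈ 𝓑 k} B` and `max_{B ∈ 𝓑̂} diam B ≤ θ · max_{B ∈ 𝓑 k} diam B`;
(iii) `𝓑 (k+1) = {B ∈ 𝓑̂ : ∃ B̂ ∈ 𝓑̂, g⁻¹(B) ∩ B̂ ≠ ∅}`. -/
def IsSubdivisionScheme {n : ℕ} (g : (Fin n → ℝ) ≃ₜ (Fin n → ℝ))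
    (Q : Set (Fin n → ℝ)) (θ : ℝ) (𝓑 : ℕ → Finset (Set (Fin n → ℝ))) : Prop :=
  (∀ k, ∀ B ∈ 𝓑 k, B.Nonempty ∧ IsCompact B) ∧
  (⋃₀ ((𝓑 0 : Finset (Set (Fin n → ℝ))) : Set (Set (Fin n → ℝ))) = Q) ∧
  (∀ k : ℕ, ∃ 𝓑hat : Finset (Set (Fin n → ℝ)),
    (∀ B ∈ 𝓑hat, B.Nonempty ∧ IsCompact B) ∧
    (⋃₀ (𝓑hat : Set (Set (Fin n → ℝ))) = ⋃₀ ((𝓑 k : Finset (Set (Fin n → ℝ))) : Set (Set (Fin n → ℝ)))) ∧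
    (sSup (Metric.diam '' (𝓑hat : Set (Set (Fin n → ℝ)))) ≤ θ * sSup (Metric.diam '' ((𝓑 k : Finset (Set (Fin n → ℝ))) : Set (Set (Fin n → ℝ))))) ∧
    ((↑(𝓑 (k + 1)) : Set (Set (Fin n → ℝ))) =
      {B ∈ (↑𝓑hat : Set (Set (Fin n → ℝ))) |
        ∃ Bhat ∈ (↑𝓑hat : Set (Set (Fin n → ℝ))), ((⇑g) ⁻¹' B ∩ Bhat).Nonempty}))

open Filter Topology in
/-- If `g.symm` almost maps `s (k + 1)` into `s k`, up to errors tending to zero, and the `s k`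
are closed and decreasing, then `⋂ k, s k` is backward invariant under `g`. -/
theorem Homeomorph.symm_mem_iInter_of_approx {X : Type*} [PseudoMetricSpace X] (g : X ≃ₜ X)
    {s : ℕ → Set X} (hs : Antitone s) (hclosed : ∀ k, IsClosed (s k)) {ε : ℕ → ℝ}
    (hε : Tendsto ε atTop (𝓝 0))
    (happrox : ∀ k, ∀ x ∈ s (k + 1), ∃ y, g y ∈ Metric.closedBall x (ε k) ∧ y ∈ s k)
    {x : X} (hx : x ∈ ⋂ k, s k) : g.symm x ∈ ⋂ k, s k := by
  rw [Set.mem_iInter] at hx ⊢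
  choose y hy hys using fun k => happrox k x (hx (k + 1))
  have hgy : Tendsto (fun k => g (y k)) atTop (𝓝 x) :=
    tendsto_iff_dist_tendsto_zero.2 (squeeze_zero (fun _ => dist_nonneg) hy hε)
  have hlim : Tendsto y atTop (𝓝 (g.symm x)) := by
    simpa [Function.comp_def] using (g.symm.continuous.tendsto x).comp hgy
  intro k
  exact (hclosed k).mem_of_tendsto hlim
    ((eventually_ge_atTop k).mono fun m hm => hs hm (hys m))

/-- A backward invariant subset of `Q` is contained in every forward image of `Q`. -/
theorem Equiv.subset_iInter_iterate_image {X : Type*} (g : X ≃ X) {s Q : Set X} (hsQ : s ⊆ Q)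
    (hinv : ∀ x ∈ s, g.symm x ∈ s) : s ⊆ ⋂ j : ℕ, g^[j] '' Q := by
  intro x hx
  refine Set.mem_iInter.2 fun j => ⟨g.symm^[j] x, hsQ ?_, ?_⟩
  · exact (show Set.MapsTo g.symm s s from hinv).iterate j hx
  · exact (show Function.RightInverse g.symm g from g.apply_symm_apply).iterate j x

/-- The relative attractor is backward invariant. -/
theorem Equiv.symm_mem_iInter_iterate_image {X : Type*} (g : X ≃ X) {Q : Set X} {x : X}
    (hx : x ∈ ⋂ j : ℕ, g^[j] '' Q) : g.symm x ∈ ⋂ j : ℕ, g^[j] '' Q := by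
  rw [Set.mem_iInter] at hx ⊢
  intro j
  obtain ⟨q, hq, rfl⟩ := hx (j + 1)
  exact ⟨q, hq, by rw [Function.iterate_succ_apply', g.symm_apply_apply]⟩

namespace IsSubdivisionScheme

variable {n : ℕ} {g : (Fin n → ℝ) ≃ₜ (Fin n → ℝ)} {Q : Set (Fin n → ℝ)} {θ : ℝ}
  {𝓑 : ℕ → Finset (Set (Fin n → ℝ))}

theorem isClosed_sUnion (h : IsSubdivisionScheme g Q θ 𝓑) (k : ℕ) :
    IsClosed (⋃₀ (𝓑 k : Set (Set (Fin n → ℝ)))) :=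
  Set.sUnion_eq_biUnion ▸
    (𝓑 k).finite_toSet.isClosed_biUnion fun B hB => (h.1 k B hB).2.isClosed

theorem antitone_sUnion (h : IsSubdivisionScheme g Q θ 𝓑) :
    Antitone fun k => ⋃₀ (𝓑 k : Set (Set (Fin n → ℝ))) := by
  refine antitone_nat_of_succ_le fun k => ?_
  obtain ⟨C, -, hunion, -, hsel⟩ := h.2.2 k
  change ⋃₀ (𝓑 (k + 1) : Set (Set (Fin n → ℝ))) ⊆ _
  rw [hsel, ← hunion]
  exact Set.sUnion_subset_sUnion fun B hB => hB.1

theorem sSup_diam_succ_le (h : IsSubdivisionScheme g Q θ 𝓑) (k : ℕ) :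
    sSup (Metric.diam '' (𝓑 (k + 1) : Set (Set (Fin n → ℝ)))) ≤
      θ * sSup (Metric.diam '' (𝓑 k : Set (Set (Fin n → ℝ)))) := by
  obtain ⟨C, -, -, hdiam, hsel⟩ := h.2.2 k
  refine le_trans (Real.sSup_le ?_ (Real.sSup_nonneg ?_)) hdiam
  · rintro _ ⟨B, hB, rfl⟩
    rw [hsel] at hB
    exact le_csSup (C.finite_toSet.image _).bddAbove ⟨B, hB.1, rfl⟩
  · rintro _ ⟨B, -, rfl⟩
    exact Metric.diam_nonneg

open Filter Topology in
theorem tendsto_sSup_diam (h : IsSubdivisionScheme g Q θ 𝓑) (hθ₀ : 0 ≤ θ) (hθ₁ : θ < 1) :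
    Tendsto (fun k => sSup (Metric.diam '' (𝓑 k : Set (Set (Fin n → ℝ))))) atTop (𝓝 0) := by
  have hlim := (tendsto_pow_atTop_nhds_zero_of_lt_one hθ₀ hθ₁).mul_const
    (sSup (Metric.diam '' (𝓑 0 : Set (Set (Fin n → ℝ)))))
  rw [zero_mul] at hlim
  refine squeeze_zero (fun k => Real.sSup_nonneg ?_) (fun k => ?_) hlim
  · rintro _ ⟨B, -, rfl⟩
    exact Metric.diam_nonneg
  · induction k with
    | zero => simp
    | succ k ih =>
      rw [pow_succ', mul_assoc]
      exact (h.sSup_diam_succ_le k).trans (mul_le_mul_of_nonneg_left ih hθ₀)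

theorem exists_mem_closedBall (h : IsSubdivisionScheme g Q θ 𝓑) (k : ℕ) {x : Fin n → ℝ}
    (hx : x ∈ ⋃₀ (𝓑 (k + 1) : Set (Set (Fin n → ℝ)))) :
    ∃ y, g y ∈ Metric.closedBall x
        (sSup (Metric.diam '' (𝓑 (k + 1) : Set (Set (Fin n → ℝ))))) ∧
      y ∈ ⋃₀ (𝓑 k : Set (Set (Fin n → ℝ))) := by
  obtain ⟨B, hB, hxB⟩ := hx
  obtain ⟨C, -, hunion, -, hsel⟩ := h.2.2 k
  obtain ⟨-, B', hB', y, hyB, hyB'⟩ := hsel ▸ hB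
  refine ⟨y, ?_, hunion ▸ ⟨B', hB', hyB'⟩⟩
  exact (Metric.dist_le_diam_of_mem (h.1 _ B hB).2.isBounded hyB hxB).trans
    (le_csSup ((𝓑 (k + 1)).finite_toSet.image _).bddAbove ⟨B, hB, rfl⟩)

/-- Selection never discards a point of a backward invariant subset of `Q`. -/
theorem subset_sUnion (h : IsSubdivisionScheme g Q θ 𝓑) {s : Set (Fin n → ℝ)} (hsQ : s ⊆ Q)
    (hinv : ∀ x ∈ s, g.symm x ∈ s) (k : ℕ) : s ⊆ ⋃₀ (𝓑 k : Set (Set (Fin n → ℝ))) := by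
  induction k with
  | zero => exact h.2.1.symm ▸ hsQ
  | succ k ih =>
    obtain ⟨C, -, hunion, -, hsel⟩ := h.2.2 k
    rw [← hunion] at ih
    intro x hx
    obtain ⟨B, hB, hxB⟩ := ih hx
    obtain ⟨B', hB', hxB'⟩ := ih (hinv x hx)
    rw [hsel]
    exact ⟨B, ⟨hB, B', hB', g.symm x, by simpa using hxB, hxB'⟩, hxB⟩

end IsSubdivisionScheme

/-- Proposition 2.1, second part: For a homeomorphism `g` of `ℝⁿ`, a
compact set `Q`, and collections `𝓑 k` generated by the subdivision scheme with
contraction factor `0 < θ < 1`, setting `Q_k = ⋃_{B ∈ 𝓑 k} B` and `Q_∞ = ⋂_k Q_k`,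
one has `A_Q = ⋂_{j ≥ 0} g^j(Q) = Q_∞`. -/
theorem relative_attractor_eq_subdivision_limit {n : ℕ}
    (g : (Fin n → ℝ) ≃ₜ (Fin n → ℝ)) (Q : Set (Fin n → ℝ)) (θ : ℝ)
    (hθ₀ : 0 < θ) (hθ₁ : θ < 1) (hQ : IsCompact Q)
    (𝓑 : ℕ → Finset (Set (Fin n → ℝ)))
    (h𝓑 : IsSubdivisionScheme g Q θ 𝓑) :
    (⋂ j : ℕ, (⇑g)^[j] '' Q) =
      ⋂ k : ℕ, ⋃₀ ((𝓑 k : Finset (Set (Fin n → ℝ))) : Set (Set (Fin n → ℝ))) := by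
  apply Set.Subset.antisymm
  · refine Set.subset_iInter (h𝓑.subset_sUnion ?_ fun x => g.toEquiv.symm_mem_iInter_iterate_image)
    exact (Set.iInter_subset _ 0).trans (by simp)
  · refine g.toEquiv.subset_iInter_iterate_image ?_ fun x hx => ?_
    · exact (Set.iInter_subset _ 0).trans h𝓑.2.1.subset
    · exact g.symm_mem_iInter_of_approx h𝓑.antitone_sUnion h𝓑.isClosed_sUnion
        ((h𝓑.tendsto_sSup_diam hθ₀.le hθ₁).comp (Filter.tendsto_add_atTop_nat 1))
        (fun k x hx => h𝓑.exists_mem_closedBall k hx) hx
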